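/- For every integer m ≥ 2 and every integer i with 1 ≤ i ≤ m−1, the Boros–Moll coefficients satisfy the strict log-concavity inequality d_i(m)^2 > d_{i-1}(m) · d_{i+1}(m). -/

import Mathlib

/-- The Boros-Moll coefficient `d_i(m)`, as a real number:
`d_i(m) = 4^(-m) * sum_{k=0}^m 2^k * C(2m-2k, m-k) * C(m+k, m) * C(k, i)`. -/
noncomputable def d (m i : ℕ) : ℝ :=
  (∑ k ∈ Finset.range (m + 1),
      (2 : ℝ) ^ k * (Nat.choose (2 * m - 2 * k) (m - k) : ℝ) *
        (Nat.choose (m + k) m : ℝ) * (Nat.choose k i : ℝ)) / 4 ^ m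

/-- The coefficient of `(x + 1) ^ k` in `4 ^ m` times the `m`-th Boros-Moll polynomial. -/
noncomputable def borosMollWeight (m k : ℕ) : ℝ :=
  (2 : ℝ) ^ k * (Nat.choose (2 * m - 2 * k) (m - k) : ℝ) * (Nat.choose (m + k) m : ℝ)

lemma borosMollWeight_pos {m k : ℕ} (hk : k ≤ m) : 0 < borosMollWeight m k := by
  have h1 : 0 < Nat.choose (2 * m - 2 * k) (m - k) := Nat.choose_pos (by omega)
  have h2 : 0 < Nat.choose (m + k) m := Nat.choose_pos (by omega)
  unfold borosMollWeight
  positivity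

lemma d_eq_sum_borosMollWeight (m i : ℕ) :
    d m i = (∑ k ∈ Finset.range (m + 1), borosMollWeight m k * (Nat.choose k i : ℝ)) / 4 ^ m :=
  rfl

lemma borosMollWeight_succ {m k : ℕ} (hk : k < m) :
    ((k : ℝ) + 1) * (2 * m - 1 - 2 * k) * borosMollWeight m (k + 1) =
      ((m : ℝ) - k) * (m + k + 1) * borosMollWeight m k := by
  obtain ⟨n, rfl⟩ : ∃ n, m = k + n + 1 := ⟨m - k - 1, by omega⟩
  have e1 : 2 * (k + n + 1) - 2 * (k + 1) = 2 * n := by omega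
  have e2 : k + n + 1 - (k + 1) = n := by omega
  have e3 : 2 * (k + n + 1) - 2 * k = 2 * (n + 1) := by omega
  have e4 : k + n + 1 - k = n + 1 := by omega
  have h1 : ((n : ℝ) + 1) * (Nat.choose (2 * (n + 1)) (n + 1) : ℝ) =
      2 * (2 * n + 1) * (Nat.choose (2 * n) n : ℝ) := by
    exact_mod_cast Nat.succ_mul_centralBinom_succ n
  have h2 : (Nat.choose (k + n + 1 + (k + 1)) (k + n + 1) : ℝ) * (k + 1) =
      (k + n + 1 + k + 1) * (Nat.choose (k + n + 1 + k) (k + n + 1) : ℝ) := by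
    have h := Nat.add_one_mul_choose_eq (k + n + 1 + k) k
    rw [← Nat.choose_symm_add (a := k + n + 1) (b := k),
      show k + n + 1 + k + 1 = k + n + 1 + (k + 1) by ring,
      ← Nat.choose_symm_add (a := k + n + 1) (b := k + 1)] at h
    have h' : ((k + n + 1 + (k + 1) : ℕ) : ℝ) * (Nat.choose (k + n + 1 + k) (k + n + 1) : ℝ) =
      (Nat.choose (k + n + 1 + (k + 1)) (k + n + 1) : ℝ) * ((k + 1 : ℕ) : ℝ) := by
      exact_mod_cast h
    push_cast at h'
    linarith
  unfold borosMollWeight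
  rw [e1, e2, e3, e4, pow_succ]
  push_cast
  linear_combination
    (2 * n + 1) * 2 ^ k * 2 * (Nat.choose (2 * n) n : ℝ) * h2
    - (k + n + 1 + k + 1) * 2 ^ k * (Nat.choose (k + n + 1 + k) (k + n + 1) : ℝ) * h1

lemma add_one_mul_choose_add_one_cast (k j : ℕ) :
    ((j : ℝ) + 1) * (Nat.choose k (j + 1) : ℝ) = (k - j) * (Nat.choose k j : ℝ) := by
  rcases le_or_gt j k with h | h
  · have := Nat.choose_succ_right_eq k j
    rw [← Nat.cast_sub h]
    exact_mod_cast (by linarith : (j + 1) * k.choose (j + 1) = (k - j) * k.choose j)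
  · simp [Nat.choose_eq_zero_of_lt h, Nat.choose_eq_zero_of_lt (h.trans (Nat.lt_succ_self j))]

lemma three_term_choose (m : ℝ) (k j : ℕ) :
    (m - j) * (m + j + 1) * (Nat.choose k j : ℝ)
      - (j + 1) * (2 * m + 1) * (Nat.choose k (j + 1) : ℝ)
      + (j + 1) * (j + 2) * (Nat.choose k (j + 2) : ℝ) =
    (m - k) * (m + k + 1) * (Nat.choose k j : ℝ)
      - (2 * m + 1 - 2 * k) * ((j + 1) * (Nat.choose k (j + 1) : ℝ)) := by
  have h1 := add_one_mul_choose_add_one_cast k j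
  have h2 := add_one_mul_choose_add_one_cast k (j + 1)
  push_cast at h2
  linear_combination (j + 1 : ℝ) * h2 + (-(k : ℝ) - j - 1) * h1

lemma sum_three_term_borosMollWeight (m j n : ℕ) (hn : n ≤ m) :
    ∑ k ∈ Finset.range n, borosMollWeight m k *
      (((m : ℝ) - j) * (m + j + 1) * (Nat.choose k j : ℝ)
        - (j + 1) * (2 * m + 1) * (Nat.choose k (j + 1) : ℝ)
        + (j + 1) * (j + 2) * (Nat.choose k (j + 2) : ℝ)) =
    (2 * m + 1 - 2 * n) * borosMollWeight m n * ((j + 1) * (Nat.choose n (j + 1) : ℝ)) := by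
  induction n with
  | zero => simp
  | succ n ih =>
    rw [Finset.sum_range_succ, ih (by omega), three_term_choose]
    have h1 := borosMollWeight_succ (m := m) (k := n) (by omega)
    have h2 : ((n : ℝ) + 1) * (Nat.choose n j : ℝ) =
        (Nat.choose (n + 1) (j + 1) : ℝ) * (j + 1) := by
      exact_mod_cast Nat.add_one_mul_choose_eq n j
    push_cast
    linear_combination (-(Nat.choose n j : ℝ)) * h1
      + (2 * m - 1 - 2 * n) * borosMollWeight m (n + 1) * h2

lemma d_three_term (m j : ℕ) :
    ((m : ℝ) - j) * (m + j + 1) * d m j - (j + 1) * (2 * m + 1) * d m (j + 1)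
      + (j + 1) * (j + 2) * d m (j + 2) = 0 := by
  have h := sum_three_term_borosMollWeight m j m le_rfl
  have h' : ∑ k ∈ Finset.range (m + 1), borosMollWeight m k *
      (((m : ℝ) - j) * (m + j + 1) * (Nat.choose k j : ℝ)
        - (j + 1) * (2 * m + 1) * (Nat.choose k (j + 1) : ℝ)
        + (j + 1) * (j + 2) * (Nat.choose k (j + 2) : ℝ)) = 0 := by
    rw [Finset.sum_range_succ, h, three_term_choose]
    ring
  simp only [d_eq_sum_borosMollWeight, ← mul_div_assoc, ← sub_div, ← add_div, Finset.mul_sum,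
    ← Finset.sum_sub_distrib, ← Finset.sum_add_distrib]
  rw [div_eq_zero_iff]
  left
  rw [← h']
  exact Finset.sum_congr rfl fun k _ => by ring

lemma d_pos {m i : ℕ} (hi : i ≤ m) : 0 < d m i := by
  rw [d_eq_sum_borosMollWeight]
  refine div_pos (Finset.sum_pos' (fun k hk => ?_) ⟨m, by simp, ?_⟩) (by positivity)
  · have := borosMollWeight_pos (m := m) (k := k) (by simp at hk; omega)
    positivity
  · exact mul_pos (borosMollWeight_pos le_rfl) (by exact_mod_cast Nat.choose_pos hi)

lemma add_one_mul_d_add_one_le (m j : ℕ) :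
    ((j : ℝ) + 1) * d m (j + 1) ≤ (m - j) * d m j := by
  simp only [d_eq_sum_borosMollWeight, ← mul_div_assoc, Finset.mul_sum]
  gcongr ?_ / _
  refine Finset.sum_le_sum fun k hk => ?_
  have hk : k ≤ m := by simp at hk; omega
  have hk' : (k : ℝ) ≤ m := by exact_mod_cast hk
  have hw := borosMollWeight_pos hk
  calc ((j : ℝ) + 1) * (borosMollWeight m k * (Nat.choose k (j + 1) : ℝ))
      = (k - j) * (borosMollWeight m k * (Nat.choose k j : ℝ)) := by
        linear_combination borosMollWeight m k * add_one_mul_choose_add_one_cast k j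
    _ ≤ (m - j) * (borosMollWeight m k * (Nat.choose k j : ℝ)) := by gcongr

lemma mul_lt_sq_of_three_term {m p x y z : ℝ} (hp : 1 ≤ p) (hpm : p ≤ m) (hx : 0 < x)
    (hrec : (m + 1 - p) * (m + p) * x - p * (2 * m + 1) * y + p * (p + 1) * z = 0)
    (hle : p * y ≤ (m + 1 - p) * x) : x * z < y ^ 2 := by
  have hp0 : 0 < p := by linarith
  have hN : 0 < m + 1 - p := by linarith
  rcases le_total (2 * m + 2) (2 * p ^ 2 + p) with h | h
  · have hw : 0 ≤ (m + 1 - p) * x - p * y := by linarith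
    have key : p ^ 2 * (p + 1) * (y ^ 2 - x * z) =
        (p + 1) * ((m + 1 - p) * x - p * y) ^ 2
        + ((m + 1 - p) * x - p * y) * x * (2 * p ^ 2 + p - (2 * m + 2))
        + x ^ 2 * (m + 1 - p) ^ 2 := by
      linear_combination (-p * x) * hrec
    have h1 : 0 < p ^ 2 * (p + 1) * (y ^ 2 - x * z) := by
      rw [key]
      have := mul_nonneg (mul_nonneg hw hx.le) (sub_nonneg.2 h)
      positivity
    have := pos_of_mul_pos_right h1 (by positivity)
    linarith
  · have key : 4 * (p * (p + 1)) ^ 2 * (y ^ 2 - x * z) =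
        (2 * p * (p + 1) * y - p * (2 * m + 1) * x) ^ 2
        + x ^ 2 * (p * (4 * m ^ 2 + 4 * m + 3 * p - 4 * p ^ 3)) := by
      linear_combination (-4 * p * (p + 1) * x) * hrec
    have hdisc : 0 < 4 * m ^ 2 + 4 * m + 3 * p - 4 * p ^ 3 := by
      have h2 : (2 * p ^ 2 + p - 1) ^ 2 ≤ (2 * m + 1) ^ 2 :=
        pow_le_pow_left₀ (by nlinarith) (by linarith) 2
      nlinarith [mul_pos hp0 hp0, mul_nonneg (sq_nonneg p) (sub_nonneg.2 hp), pow_pos hp0 4,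
        sq_nonneg (p ^ 2 - 1), sq_nonneg (p - 1)]
    have h1 : 0 < 4 * (p * (p + 1)) ^ 2 * (y ^ 2 - x * z) := by
      rw [key]
      positivity
    have := pos_of_mul_pos_right h1 (by positivity)
    linarith

theorem boros_moll_log_concave (m i : ℕ) (hm : 2 ≤ m) (hi : 1 ≤ i) (hi' : i ≤ m - 1) :
    d m i ^ 2 > d m (i - 1) * d m (i + 1) := by
  obtain ⟨j, rfl⟩ : ∃ j, i = j + 1 := ⟨i - 1, by omega⟩
  have hjm : ((j : ℝ) + 1) ≤ m := by exact_mod_cast (by omega : j + 1 ≤ m)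
  have hrec := d_three_term m j
  have hle := add_one_mul_d_add_one_le m j
  refine mul_lt_sq_of_three_term (m := m) (p := (j : ℝ) + 1) (by simp) hjm
    (d_pos (by omega)) ?_ ?_
  · rw [Nat.add_sub_cancel]
    linear_combination hrec
  · rw [Nat.add_sub_cancel]
    linarith
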